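/- arXiv:2303.12491 — 4 statements merged into one kernel-verified Lean document; each statement's English description precedes it below -/
import Mathlib

section
/- Let n ≥ 2 and let G be the power graph of the cyclic group Z_n of integers modulo n. For each divisor d of n with d < n, set V_d = {x ∈ Z_n : gcd(x, n) = d} if d > 1, and V_1 = {x ∈ Z_n : gcd(x, n) = 1} ∪ {0}. Then: (1) the sets V_d (d a divisor of n, d < n) partition Z_n; (2) |V_d| = φ(n/d) for d > 1 and |V_1| = φ(n) + 1, where φ is Euler's totient function; (3) each V_d induces a complete subgraph of G; and (4) for distinct divisors d, e < n of n, a vertex of V_d is adjacent in G to a vertex of V_e if and only if d divides e or e divides d. Consequently, G is the generalized composition H[K_{φ(n)+1}, K_{φ(n/d_1)}, …, K_{φ(n/d_t)}], where 1, d_1, …, d_t are the divisors of n less than n and H is the graph on these divisors with d adjacent to e iff d | e or e | d. -/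
open SimpleGraph

/-- The *power graph* of the additive cyclic group `ZMod n`: distinct elements `a` and
`b` are adjacent iff `a` is a positive multiple of `b` or `b` is a positive multiple of
`a` (the additive analogue of "a is a positive power of b"). -/
def zmodPowerGraph (n : ℕ) : SimpleGraph (ZMod n) where
  Adj a b := a ≠ b ∧ ((∃ m : ℕ, 0 < m ∧ a = m • b) ∨ (∃ m : ℕ, 0 < m ∧ b = m • a))
  symm := ⟨fun a b h => ⟨h.1.symm, h.2.symm⟩⟩
  loopless := ⟨fun a h => h.1 rfl⟩

/-- For a divisor `d` of `n` with `d < n`, the set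
`V_d = {x ∈ Z_n : gcd(x, n) = d}` if `d > 1`, and
`V_1 = {x ∈ Z_n : gcd(x, n) = 1} ∪ {0}`. -/
def Vd (n d : ℕ) : Set (ZMod n) :=
  if d = 1 then {x | Nat.gcd x.val n = 1} ∪ {0} else {x | Nat.gcd x.val n = d}

/-- In `ZMod n`, an element `a` is a positive multiple of `b` iff `gcd(b, n)` divides
`gcd(a, n)`. -/
theorem exists_pos_nsmul_eq_iff_gcd_dvd {n : ℕ} [NeZero n] (a b : ZMod n) :
    (∃ m : ℕ, 0 < m ∧ a = m • b) ↔ Nat.gcd b.val n ∣ Nat.gcd a.val n := by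
  constructor
  · rintro ⟨m, -, rfl⟩
    refine Nat.dvd_gcd ?_ (Nat.gcd_dvd_right _ _)
    rw [nsmul_eq_mul, ZMod.val_mul, Nat.dvd_mod_iff (Nat.gcd_dvd_right _ _)]
    exact (Nat.gcd_dvd_left _ _).mul_left _
  · intro h
    obtain ⟨k, hk⟩ := h.trans (Nat.gcd_dvd_left _ _)
    have bezout : ((Nat.gcd b.val n : ℕ) : ZMod n) = b * (Nat.gcdA b.val n : ZMod n) := by
      have h := congrArg (Int.cast : ℤ → ZMod n) (Nat.gcd_eq_gcd_ab b.val n)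
      push_cast at h
      simpa using h
    refine ⟨((Nat.gcdA b.val n : ZMod n) * k).val + n, by have := NeZero.pos n; omega, ?_⟩
    have ha : a = ((Nat.gcd b.val n : ℕ) : ZMod n) * k := by
      rw [← Nat.cast_mul, ← hk, ZMod.natCast_zmod_val]
    rw [nsmul_eq_mul, Nat.cast_add, ZMod.natCast_zmod_val, ZMod.natCast_self, add_zero]
    rw [ha, bezout]
    ring

theorem ncard_setOf_gcd_val_eq {n d : ℕ} [NeZero n] (hd : d ∣ n) :
    {x : ZMod n | Nat.gcd x.val n = d}.ncard = Nat.totient (n / d) := by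
  rw [Nat.totient_div_of_dvd hd, ← Set.ncard_coe_finset,
    ← Set.ncard_image_of_injective _ (ZMod.val_injective n)]
  congr 1
  ext k
  simp only [Set.mem_image, Set.mem_ofPred_eq, Finset.coe_filter, Finset.mem_range]
  constructor
  · rintro ⟨x, hx, rfl⟩
    exact ⟨ZMod.val_lt x, by rwa [Nat.gcd_comm]⟩
  · rintro ⟨hk, hkd⟩
    refine ⟨k, ?_, ZMod.val_cast_of_lt hk⟩
    rwa [ZMod.val_cast_of_lt hk, Nat.gcd_comm]

/-- The index `d` of the part `Vd n d` containing `x`. -/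
def partIndex {n : ℕ} (x : ZMod n) : ℕ :=
  if x = 0 then 1 else Nat.gcd x.val n

theorem partIndex_dvd {n : ℕ} (x : ZMod n) : partIndex x ∣ n := by
  unfold partIndex
  split_ifs
  · exact one_dvd n
  · exact Nat.gcd_dvd_right _ _

theorem partIndex_lt {n : ℕ} (hn : 2 ≤ n) (x : ZMod n) : partIndex x < n := by
  have : NeZero n := ⟨by omega⟩
  unfold partIndex
  split_ifs with hx
  · omega
  · exact (Nat.gcd_le_left n (ZMod.val_pos.2 hx)).trans_lt (ZMod.val_lt x)

theorem mem_Vd_iff {n d : ℕ} (hd : d < n) (x : ZMod n) :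
    x ∈ Vd n d ↔ partIndex x = d := by
  unfold Vd partIndex
  by_cases hx : x = 0
  · subst hx
    rw [if_pos (rfl : (0 : ZMod n) = 0)]
    split_ifs with h
    · simp [h]
    · simp only [Set.mem_ofPred_eq, ZMod.val_zero, Nat.gcd_zero_left]
      omega
  · split_ifs with h <;> simp [hx, h]

theorem zmodPowerGraph_adj_iff {n : ℕ} (hn : 2 ≤ n) {x y : ZMod n} (hxy : x ≠ y) :
    (zmodPowerGraph n).Adj x y ↔
      partIndex x ∣ partIndex y ∨ partIndex y ∣ partIndex x := by
  have : NeZero n := ⟨by omega⟩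
  change x ≠ y ∧ _ ↔ _
  rw [exists_pos_nsmul_eq_iff_gcd_dvd, exists_pos_nsmul_eq_iff_gcd_dvd]
  unfold partIndex
  by_cases hx : x = 0
  · simp [hx, hx ▸ hxy, Nat.gcd_dvd_right]
  by_cases hy : y = 0
  · simp [hy, hx, Nat.gcd_dvd_right]
  simp [hx, hy, hxy, or_comm]

/-- Let `n ≥ 2` and let `G` be the power graph of `Z_n`.  Then:
(1) the sets `V_d` (`d ∣ n`, `d < n`) partition `Z_n`;
(2) `|V_d| = φ(n/d)` for `d > 1`, and `|V_1| = φ(n) + 1`;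
(3) each `V_d` induces a complete subgraph of `G`;
(4) for distinct divisors `d, e < n` of `n`, a vertex of `V_d` is adjacent in `G` to a
vertex of `V_e` iff `d ∣ e` or `e ∣ d`.
Consequently, `G` is the generalized composition of the complete graphs on the `V_d`
over the graph `H` on the divisors of `n` less than `n`, with `d` adjacent to `e` iff
`d ∣ e` or `e ∣ d`: for distinct `x, y`, `x` and `y` are adjacent in `G` iff they lie in
parts `V_d`, `V_e` with `d = e`, `d ∣ e` or `e ∣ d`. -/
theorem zmodPowerGraph_structure (n : ℕ) (hn : 2 ≤ n) :
    (∀ x : ZMod n, ∃! d : ℕ, d ∣ n ∧ d < n ∧ x ∈ Vd n d) ∧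
    (∀ d : ℕ, d ∣ n → d < n → 1 < d → (Vd n d).ncard = Nat.totient (n / d)) ∧
    ((Vd n 1).ncard = Nat.totient n + 1) ∧
    (∀ d : ℕ, d ∣ n → d < n →
      ∀ x ∈ Vd n d, ∀ y ∈ Vd n d, x ≠ y → (zmodPowerGraph n).Adj x y) ∧
    (∀ d e : ℕ, d ∣ n → e ∣ n → d < n → e < n → d ≠ e →
      ∀ x ∈ Vd n d, ∀ y ∈ Vd n e,
        ((zmodPowerGraph n).Adj x y ↔ (d ∣ e ∨ e ∣ d))) ∧
    (∀ x y : ZMod n, x ≠ y →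
      ((zmodPowerGraph n).Adj x y ↔
        ∃ d e : ℕ, d ∣ n ∧ d < n ∧ e ∣ n ∧ e < n ∧ x ∈ Vd n d ∧ y ∈ Vd n e ∧
          (d = e ∨ d ∣ e ∨ e ∣ d))) := by
  have : NeZero n := ⟨by omega⟩
  refine ⟨fun x => ?_, fun d hd _ hd1 => ?_, ?_, fun d _ hdn x hx y hy hxy => ?_,
    fun d e _ _ hdn hen hde x hx y hy => ?_, fun x y hxy => ?_⟩
  · refine ⟨partIndex x, ⟨partIndex_dvd x, partIndex_lt hn x,
      (mem_Vd_iff (partIndex_lt hn x) x).2 rfl⟩, ?_⟩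
    rintro d ⟨-, hdn, hx⟩
    exact ((mem_Vd_iff hdn x).1 hx).symm
  · rw [Vd, if_neg hd1.ne', ncard_setOf_gcd_val_eq hd]
  · have h0 : (0 : ZMod n) ∉ {x : ZMod n | Nat.gcd x.val n = 1} := by
      simp only [Set.mem_ofPred_eq, ZMod.val_zero, Nat.gcd_zero_left]
      omega
    rw [Vd, if_pos rfl, Set.union_singleton, Set.ncard_insert_of_notMem h0,
      ncard_setOf_gcd_val_eq (one_dvd n), Nat.div_one]
  · rw [mem_Vd_iff hdn] at hx hy
    rw [zmodPowerGraph_adj_iff hn hxy, hx, hy]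
    simp
  · rw [mem_Vd_iff hdn] at hx
    rw [mem_Vd_iff hen] at hy
    have hxy : x ≠ y := by
      rintro rfl
      exact hde (hx.symm.trans hy)
    rw [zmodPowerGraph_adj_iff hn hxy, hx, hy]
  · rw [zmodPowerGraph_adj_iff hn hxy]
    constructor
    · intro h
      exact ⟨partIndex x, partIndex y, partIndex_dvd x, partIndex_lt hn x, partIndex_dvd y,
        partIndex_lt hn y, (mem_Vd_iff (partIndex_lt hn x) x).2 rfl,
        (mem_Vd_iff (partIndex_lt hn y) y).2 rfl, Or.inr h⟩
    · rintro ⟨d, e, -, hdn, -, hen, hx, hy, h⟩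
      rw [mem_Vd_iff hdn] at hx
      rw [mem_Vd_iff hen] at hy
      rw [hx, hy]
      rcases h with rfl | h
      · exact Or.inl dvd_rfl
      · exact h
end

section
/- Let Γ be a finite group of order n ≥ 2 in which every non-identity element has order 2 (i.e., x² = e for all x ∈ Γ), and let G be the power graph of Γ. Then G is isomorphic to the star K_{1, n−1}, and for every m with 1 < m < n, the m-Steiner Wiener index of G equals SW_m(G) = m·C(n−1, m) + (m−1)·C(n−1, m−1). -/
open SimpleGraph

/-- The *power graph* of a group `Γ`: distinct elements `a` and `b` are adjacent iff
`a` is a positive power of `b` or `b` is a positive power of `a`. -/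
def powerGraph (Γ : Type*) [Group Γ] : SimpleGraph Γ where
  Adj a b := a ≠ b ∧ ((∃ m : ℕ, 0 < m ∧ a = b ^ m) ∨ (∃ m : ℕ, 0 < m ∧ b = a ^ m))
  symm := ⟨fun a b h => ⟨h.1.symm, h.2.symm⟩⟩
  loopless := ⟨fun a h => h.1 rfl⟩

/-- The *Steiner distance* of a set `S` of vertices of `G`: the minimum number of edges
of a connected subgraph of `G` containing all vertices of `S`. -/
noncomputable def steinerDist {V : Type*} (G : SimpleGraph V) (S : Set V) : ℕ :=
  sInf {n | ∃ T : G.Subgraph, T.Connected ∧ S ⊆ T.verts ∧ T.edgeSet.ncard = n}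

/-- The *m-Steiner Wiener index* of `G`: the sum of the Steiner distances of all
`m`-element subsets of the vertex set of `G`. -/
noncomputable def steinerWiener {V : Type*} [Fintype V] (m : ℕ) (G : SimpleGraph V) : ℕ :=
  ∑ S ∈ Finset.powersetCard m (Finset.univ : Finset V), steinerDist G (S : Set V)

namespace SimpleGraph

variable {V : Type*}

/-- The subgraph of a star induced on a vertex set containing the centre is connected. -/
lemma connected_induce_starGraph {c : V} {s : Set V} (hc : c ∈ s) :
    ((⊤ : (starGraph c).Subgraph).induce s).Connected := by
  rw [← connected_induce_iff]
  refine .of_isUniversal (v := ⟨c, hc⟩) fun w hw => ?_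
  simpa [Subtype.ext_iff] using hw

/-- A star with `n` vertices is isomorphic to the complete bipartite graph `K_{1, n - 1}`. -/
lemma nonempty_starGraph_iso_completeBipartiteGraph [Fintype V] (c : V) :
    Nonempty (starGraph c ≃g
      completeBipartiteGraph (Fin 1) (Fin (Fintype.card V - 1))) := by
  classical
  let e₁ : {x // x = c} ≃ Fin 1 := Fintype.equivFinOfCardEq (by simp)
  let e₂ : {x // ¬x = c} ≃ Fin (Fintype.card V - 1) :=
    Fintype.equivFinOfCardEq (by rw [Fintype.card_subtype_compl]; simp)
  refine ⟨⟨(Equiv.sumCompl (· = c)).symm.trans (Equiv.sumCongr e₁ e₂), fun {a b} => ?_⟩⟩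
  by_cases ha : a = c <;> by_cases hb : b = c
  · simp [ha, hb]
  · simp [ha, hb, Ne.symm hb]
  · simp [ha, hb]
  · simp [ha, hb]

end SimpleGraph

/-- In a star, the Steiner distance of a set with at least two vertices is the number of
its vertices other than the centre. -/
lemma steinerDist_starGraph {V : Type*} [Finite V] [DecidableEq V] (c : V) (S : Finset V)
    (hS : 1 < S.card) : steinerDist (starGraph c) (S : Set V) = (S.erase c).card := by
  have hinj : Function.Injective fun v => s(c, v) := fun v w h => Sym2.congr_right.mp h
  have hcard : ((fun v => s(c, v)) '' (S.erase c : Set V)).ncard = (S.erase c).card := by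
    rw [Set.ncard_image_of_injective _ hinj, Set.ncard_coe_finset]
  refine (IsLeast.csInf_eq ⟨⟨(⊤ : (starGraph c).Subgraph).induce (insert c (S : Set V)),
    connected_induce_starGraph (Set.mem_insert _ _), Set.subset_insert _ _, ?_⟩, ?_⟩)
  · rw [← hcard]
    congr 1
    ext e
    induction e with | _ a b
    simp
    grind
  · rintro _ ⟨T, hT, hST, rfl⟩
    rw [← hcard]
    refine Set.ncard_le_ncard ?_ (Set.toFinite _)
    rintro _ ⟨v, hv, rfl⟩
    obtain ⟨hvc, hvS⟩ := Finset.mem_erase.mp hv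
    have : Nontrivial T.verts :=
      ((Finset.one_lt_card_iff_nontrivial.mp hS).mono hST).coe_sort
    obtain ⟨w, hw⟩ := hT.preconnected.exists_adj_of_nontrivial ⟨v, hST hvS⟩
    obtain rfl : w = c := (starGraph_adj.mp hw.adj_sub).2.resolve_left hvc
    exact hw.symm

/-- The Steiner Wiener index of a star: the `m`-sets avoiding the centre contribute `m` each,
those containing it contribute `m - 1` each. -/
lemma steinerWiener_starGraph {V : Type*} [Fintype V] (c : V) {m : ℕ} (hm : 1 < m) :
    steinerWiener m (starGraph c) = m * (Fintype.card V - 1).choose m +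
      (m - 1) * (Fintype.card V - 1).choose (m - 1) := by
  classical
  obtain ⟨k, rfl⟩ : ∃ k, m = k + 1 := ⟨m - 1, by omega⟩
  have hc : c ∉ (Finset.univ : Finset V).erase c := Finset.notMem_erase _ _
  have hmem {j : ℕ} {S : Finset V}
      (hS : S ∈ Finset.powersetCard j ((Finset.univ : Finset V).erase c)) :
      c ∉ S ∧ S.card = j := by
    rw [Finset.mem_powersetCard] at hS
    exact ⟨fun h => hc (hS.1 h), hS.2⟩
  have hcard : ((Finset.univ : Finset V).erase c).card = Fintype.card V - 1 := by
    simp [Finset.card_erase_of_mem]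
  rw [steinerWiener, Finset.sum_congr rfl fun S hS => steinerDist_starGraph c S
    (by rwa [(Finset.mem_powersetCard.mp hS).2]),
    ← Finset.insert_erase (Finset.mem_univ c), Finset.powersetCard_succ_insert hc,
    Finset.sum_union, Finset.sum_image]
  · congr 1
    · rw [Finset.sum_congr rfl fun S hS => by
        rw [Finset.erase_eq_of_notMem (hmem hS).1, (hmem hS).2]]
      simp [hcard, mul_comm]
    · rw [Finset.sum_congr rfl fun S hS => by
        rw [Finset.erase_insert (hmem hS).1, (hmem hS).2]]
      simp [hcard, mul_comm]
  · intro S hS T hT h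
    rw [← Finset.erase_insert (hmem hS).1, ← Finset.erase_insert (hmem hT).1]
    exact congrArg (Finset.erase · c) h
  · rw [Finset.disjoint_left]
    intro S hS hS'
    obtain ⟨T, -, rfl⟩ := Finset.mem_image.mp hS'
    exact (hmem hS).1 (Finset.mem_insert_self _ _)

/-- The power graph of a group of exponent dividing two is the star centred at the identity. -/
lemma powerGraph_eq_starGraph {Γ : Type*} [Group Γ] (hsq : ∀ x : Γ, x * x = 1) :
    powerGraph Γ = starGraph 1 := by
  have hpow (x : Γ) (k : ℕ) : x ^ k = 1 ∨ x ^ k = x := by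
    induction k with
    | zero => simp
    | succ k ih => rcases ih with h | h <;> simp [pow_succ, h, hsq]
  ext a b
  rw [starGraph_adj]
  refine and_congr_right fun hab => ⟨?_, ?_⟩
  · rintro (⟨k, -, rfl⟩ | ⟨k, -, rfl⟩)
    · exact .inl ((hpow b k).resolve_right hab)
    · exact .inr ((hpow a k).resolve_right hab.symm)
  · rintro (rfl | rfl)
    · exact .inl ⟨2, two_pos, by rw [pow_two, hsq]⟩
    · exact .inr ⟨2, two_pos, by rw [pow_two, hsq]⟩

/-- Let `Γ` be a finite group of order `n ≥ 2` in which every element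
squares to the identity, and let `G` be the power graph of `Γ`.  Then `G` is isomorphic
to the star `K_{1,n−1}` (the complete bipartite graph with parts of sizes `1` and
`n − 1`), and for every `m` with `1 < m < n`, the `m`-Steiner Wiener index of `G` equals
`SW_m(G) = m·C(n−1, m) + (m−1)·C(n−1, m−1)`. -/
theorem steinerWiener_powerGraph_of_exponent_two {Γ : Type*} [Group Γ] [Fintype Γ]
    (n : ℕ) (hn : 2 ≤ n) (hcard : Fintype.card Γ = n)
    (hsq : ∀ x : Γ, x * x = 1)
    (m : ℕ) (hm1 : 1 < m) (hmn : m < n) :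
    Nonempty (powerGraph Γ ≃g completeBipartiteGraph (Fin 1) (Fin (n - 1))) ∧
      steinerWiener m (powerGraph Γ) =
        m * (n - 1).choose m + (m - 1) * (n - 1).choose (m - 1) := by
  subst hcard
  rw [powerGraph_eq_starGraph hsq]
  exact ⟨nonempty_starGraph_iso_completeBipartiteGraph 1, steinerWiener_starGraph 1 hm1⟩
end

section
/- Let R be a finite commutative ring with unity, let I be an ideal of R, and assume the ideal-based zero-divisor graph Γ_I(R) is connected with at least m vertices, where m ≥ 2. Let C_1, …, C_k be the twin classes of Γ_I(R) with sizes n_i = |C_i|, representatives c_i ∈ C_i, and reduced graph H (the subgraph induced by {c_1, …, c_k}). Then SW_m(Γ_I(R)) = Σ_{i : Γ_I(R)[C_i] complete} (m−1)·C(n_i, m) + Σ_{i : Γ_I(R)[C_i] edgeless} m·C(n_i, m) + Σ_{S, |S| = m, |I(S)| > 1} ( d_H(S_r) + Σ_{i ∈ I(S)} (t_i − 1) ), where the last sum is over m-subsets S of the vertex set meeting at least two twin classes, I(S) = {i : S ∩ C_i ≠ ∅}, t_i = |S ∩ C_i|, S_r = {c_i : i ∈ I(S)}, and d_H(S_r)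 is the Steiner distance of S_r in H. -/
open SimpleGraph

/-- Two vertices `u` and `v` of a simple graph are *twins* if
`N(u) \ {v} = N(v) \ {u}`, where `N` denotes the open neighborhood. -/
def IsTwin {V : Type*} (G : SimpleGraph V) (u v : V) : Prop :=
  G.neighborSet u \ {v} = G.neighborSet v \ {u}

/-- The *ideal-based zero-divisor graph* `Γ_I(R)`: vertices are the `x ∈ R \ I` with
`x * y ∈ I` for some `y ∈ R \ I`; distinct vertices `x, y` are adjacent iff `x * y ∈ I`. -/
def idealZeroDivisorGraph (R : Type*) [CommRing R] (I : Ideal R) :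
    SimpleGraph {x : R // x ∉ I ∧ ∃ y, y ∉ I ∧ x * y ∈ I} where
  Adj a b := a ≠ b ∧ a.1 * b.1 ∈ I
  symm := ⟨fun a b h => ⟨h.1.symm, by rw [mul_comm]; exact h.2⟩⟩
  loopless := ⟨fun a h => h.1 rfl⟩

instance {R : Type*} [CommRing R] [Fintype R] [DecidableEq R] (I : Ideal R)
    [DecidablePred (· ∈ I)] :
    Fintype {x : R // x ∉ I ∧ ∃ y, y ∉ I ∧ x * y ∈ I} :=
  Subtype.fintype _

instance {R : Type*} [CommRing R] [DecidableEq R] (I : Ideal R)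
    [DecidablePred (· ∈ I)] :
    DecidableRel (idealZeroDivisorGraph R I).Adj :=
  fun a b => inferInstanceAs (Decidable (a ≠ b ∧ a.1 * b.1 ∈ I))

section SteinerDistance

variable {V V' : Type*}

/-- A connected induced subgraph on `W ⊇ S` has a spanning tree with `|W| - 1` edges, which bounds
the Steiner distance of `S`. -/
theorem steinerDist_add_one_le_ncard [Finite V] {G : SimpleGraph V} {S W : Set V} (hSW : S ⊆ W)
    (hW : (G.induce W).Connected) : steinerDist G S + 1 ≤ W.ncard := by
  classical
  have := Fintype.ofFinite V
  obtain ⟨T, hTG, hT⟩ := hW.exists_isTree_le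
  let T' : G.Subgraph :=
    { verts := W
      Adj := fun a b => ∃ (ha : a ∈ W) (hb : b ∈ W), T.Adj ⟨a, ha⟩ ⟨b, hb⟩
      adj_sub := fun ⟨_, _, h⟩ => hTG h
      edge_vert := fun ⟨h, _, _⟩ => h
      symm := ⟨fun _ _ ⟨ha, hb, h⟩ => ⟨hb, ha, h.symm⟩⟩ }
  have hconn : T'.Connected :=
    ⟨hT.connected.map (H := T'.coe) ⟨id, fun {a b} h => ⟨a.2, b.2, h⟩⟩ Function.surjective_id⟩
  have hedge : T'.edgeSet ⊆ Sym2.map Subtype.val '' T.edgeSet := by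
    intro e
    induction e using Sym2.ind with
    | h a b =>
      rintro ⟨ha, hb, h⟩
      exact ⟨s(⟨a, ha⟩, ⟨b, hb⟩), h, rfl⟩
  have hle : steinerDist G S ≤ T'.edgeSet.ncard := Nat.sInf_le ⟨T', hconn, hSW, rfl⟩
  have hcard : T'.edgeSet.ncard ≤ T.edgeSet.ncard :=
    (Set.ncard_le_ncard hedge (Set.toFinite _)).trans (Set.ncard_image_le (Set.toFinite _))
  have hT' := hT.card_edgeFinset
  rw [← Set.ncard_coe_finset, SimpleGraph.coe_edgeFinset, ← Nat.card_eq_fintype_card,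
    Nat.card_coe_set_eq] at hT'
  omega

/-- The Steiner distance is attained by a connected induced subgraph. -/
theorem exists_induce_connected_ncard_le [Finite V] {G : SimpleGraph V} (hG : G.Connected)
    (S : Set V) :
    ∃ W, S ⊆ W ∧ (G.induce W).Connected ∧ W.ncard ≤ steinerDist G S + 1 := by
  have hne : {n | ∃ T : G.Subgraph, T.Connected ∧ S ⊆ T.verts ∧ T.edgeSet.ncard = n}.Nonempty :=
    ⟨_, _, SimpleGraph.Connected.toSubgraph le_rfl hG, fun _ _ => trivial, rfl⟩
  obtain ⟨T, hT, hST, hcard⟩ := Nat.sInf_mem hne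
  refine ⟨T.verts, hST, hT.induce_verts, ?_⟩
  have h := hT.coe.card_vert_le_card_edgeSet_add_one
  rwa [Nat.card_coe_set_eq, Nat.card_coe_set_eq,
    ← Set.ncard_image_of_injective _ (Sym2.map.injective Subtype.val_injective),
    Subgraph.image_coe_edgeSet_coe, hcard] at h

/-- Reachability passes along maps sending edges to edges or to single vertices. -/
theorem reachable_map_of_adj_or_eq {G : SimpleGraph V} {H : SimpleGraph V'} {f : V → V'}
    (hf : ∀ u v, G.Adj u v → f u ≠ f v → H.Adj (f u) (f v)) {u v : V} (h : G.Reachable u v) :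
    H.Reachable (f u) (f v) := by
  obtain ⟨p⟩ := h
  induction p with
  | nil => exact .rfl
  | @cons u w v huw p ih =>
    by_cases h : f u = f w
    · rwa [h]
    · exact (hf _ _ huw h).reachable.trans ih

variable {G : SimpleGraph V} {H : SimpleGraph V'} {r : V → V'}

theorem connected_of_adj_iff (hr : Function.Surjective r)
    (hadj : ∀ u v, r u ≠ r v → (G.Adj u v ↔ H.Adj (r u) (r v))) (hG : G.Connected) :
    H.Connected := by
  have := hG.nonempty.map r
  refine ⟨fun x y => ?_⟩
  obtain ⟨u, rfl⟩ := hr x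
  obtain ⟨v, rfl⟩ := hr y
  exact reachable_map_of_adj_or_eq (fun u v h hne => (hadj u v hne).1 h) (hG.preconnected u v)

/-- If `r` exhibits `G` as a blow-up of the connected nontrivial graph `H`, then `G` is
connected. -/
theorem connected_blowup [Nontrivial V'] (hr : Function.Surjective r)
    (hadj : ∀ u v, r u ≠ r v → (G.Adj u v ↔ H.Adj (r u) (r v))) (hH : H.Connected) :
    G.Connected := by
  have key : ∀ x y, H.Walk x y → ∀ u v, r u = x → r v = y → x ≠ y → G.Reachable u v := by
    intro x y p
    induction p with
    | nil => intro _ _ _ _ h; exact absurd rfl h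
    | @cons x z y hxz p ih =>
      rintro u v rfl rfl -
      obtain ⟨w, rfl⟩ := hr z
      by_cases hwv : r w = r v
      · rw [hwv] at hxz
        exact ((hadj u v hxz.ne).2 hxz).reachable
      · exact ((hadj u w hxz.ne).2 hxz).reachable.trans (ih w v rfl rfl hwv)
  have key' : ∀ u v, r u ≠ r v → G.Reachable u v := fun u v h =>
    (hH.preconnected (r u) (r v)).elim fun p => key _ _ p u v rfl rfl h
  have : Nonempty V := ⟨(hr hH.nonempty.some).choose⟩
  refine ⟨fun u v => ?_⟩
  by_cases huv : r u = r v
  · obtain ⟨z, hz⟩ := exists_ne (r u)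
    obtain ⟨w, rfl⟩ := hr z
    exact (key' u w hz.symm).trans (key' w v (huv ▸ hz))
  · exact key' u v huv

/-- The Steiner distance of a set in a blow-up of `H`, for a set that meets at least two fibres. -/
theorem steinerDist_add_ncard_image [Finite V] (hr : Function.Surjective r)
    (hadj : ∀ u v, r u ≠ r v → (G.Adj u v ↔ H.Adj (r u) (r v))) (hG : G.Connected)
    {S : Set V} (hS : (r '' S).Nontrivial) :
    steinerDist G S + (r '' S).ncard = steinerDist H (r '' S) + S.ncard := by
  have := Finite.of_surjective r hr
  have hrestrict : ∀ (W : Set V) (W' : Set V') (h : Set.MapsTo r W W') (u v : W),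
      h.restrict r W W' u ≠ h.restrict r W W' v →
      ((G.induce W).Adj u v ↔
        (H.induce W').Adj (h.restrict r W W' u) (h.restrict r W W' v)) :=
    fun W W' h u v huv => hadj u v fun h' => huv (Subtype.ext h')
  apply le_antisymm
  · obtain ⟨W', hSW, hconn, hcard⟩ :=
      exists_induce_connected_ncard_le (connected_of_adj_iff hr hadj hG) (r '' S)
    let W := S ∪ Function.surjInv hr '' (W' \ r '' S)
    have hmaps : Set.MapsTo r W W' := by
      rintro v (hv | ⟨x, hx, rfl⟩)
      · exact hSW ⟨v, hv, rfl⟩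
      · rw [Function.surjInv_eq hr]; exact hx.1
    have hsurj : Function.Surjective (hmaps.restrict r W W') := by
      rintro ⟨x, hx⟩
      by_cases hxS : x ∈ r '' S
      · obtain ⟨v, hv, rfl⟩ := hxS
        exact ⟨⟨v, Or.inl hv⟩, rfl⟩
      · exact ⟨⟨_, Or.inr ⟨x, ⟨hx, hxS⟩, rfl⟩⟩, Subtype.ext (Function.surjInv_eq hr x)⟩
    have := (hS.mono hSW).coe_sort
    have h1 := steinerDist_add_one_le_ncard (S := S) Set.subset_union_left
      (connected_blowup hsurj (hrestrict W W' hmaps) hconn)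
    have h2 := Set.ncard_union_le S (Function.surjInv hr '' (W' \ r '' S))
    have h3 := Set.ncard_image_le (f := Function.surjInv hr) (Set.toFinite (W' \ r '' S))
    have h4 := Set.ncard_sdiff_add_ncard_of_subset hSW (Set.toFinite W')
    omega
  · obtain ⟨W, hSW, hconn, hcard⟩ := exists_induce_connected_ncard_le hG S
    have hmaps : Set.MapsTo r W (r '' W) := Set.mapsTo_image r W
    have hsurj : Function.Surjective (hmaps.restrict r W (r '' W)) := by
      rintro ⟨_, v, hv, rfl⟩
      exact ⟨⟨v, hv⟩, rfl⟩
    have h1 := steinerDist_add_one_le_ncard (Set.image_mono (f := r) hSW)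
      (connected_of_adj_iff hsurj (hrestrict _ _ hmaps) hconn)
    have h2 : r '' W \ r '' S ⊆ r '' (W \ S) := by
      rintro _ ⟨⟨v, hv, rfl⟩, hvS⟩
      exact ⟨v, ⟨hv, fun h => hvS ⟨v, h, rfl⟩⟩, rfl⟩
    have h3 := (Set.ncard_le_ncard h2).trans (Set.ncard_image_le (Set.toFinite (W \ S)))
    have h4 := Set.ncard_sdiff_add_ncard_of_subset hSW (Set.toFinite W)
    have h5 := Set.ncard_sdiff_add_ncard_of_subset (Set.image_mono (f := r) hSW)
      (Set.toFinite (r '' W))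
    omega

/-- The Steiner distance of a clique. -/
theorem steinerDist_of_isClique [Finite V] (hG : G.Connected) {S : Set V} (hS : S.Nonempty)
    (hclique : G.IsClique S) : steinerDist G S + 1 = S.ncard := by
  apply le_antisymm
  · have := hS.to_subtype
    refine steinerDist_add_one_le_ncard le_rfl ⟨fun u v => ?_⟩
    by_cases huv : u = v
    · rw [huv]
    · exact SimpleGraph.Adj.reachable (G := G.induce S)
        (hclique u.2 v.2 fun h => huv (Subtype.ext h))
  · obtain ⟨W, hSW, -, hcard⟩ := exists_induce_connected_ncard_le hG S
    exact (Set.ncard_le_ncard hSW).trans hcard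

/-- The Steiner distance of an independent set with a common neighbour. -/
theorem steinerDist_of_isIndepSet [Finite V] (hG : G.Connected) {S : Set V} (hS : S.Nontrivial)
    (hindep : ∀ u ∈ S, ∀ v ∈ S, ¬ G.Adj u v) {z : V} (hz : ∀ u ∈ S, G.Adj z u) :
    steinerDist G S = S.ncard := by
  apply le_antisymm
  · have hconn : (G.induce (insert z S)).Connected := by
      rw [connected_iff_exists_forall_reachable]
      refine ⟨⟨z, Set.mem_insert z S⟩, ?_⟩
      rintro ⟨v, rfl | hv⟩
      · rfl
      · exact SimpleGraph.Adj.reachable (G := G.induce (insert z S)) (hz v hv)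
    have h1 := steinerDist_add_one_le_ncard (Set.subset_insert z S) hconn
    have h2 := Set.ncard_insert_le z S
    omega
  · obtain ⟨W, hSW, hconn, hcard⟩ := exists_induce_connected_ncard_le hG S
    have hne : S ≠ W := by
      rintro rfl
      have := hS.coe_sort
      obtain ⟨u⟩ := hconn.nonempty
      obtain ⟨v, huv⟩ := hconn.preconnected.exists_adj_of_nontrivial u
      exact hindep u u.2 v v.2 huv
    have := Set.ncard_lt_ncard (hSW.ssubset_of_ne hne)
    omega

end SteinerDistance

section TwinClasses

variable {V : Type*} {G : SimpleGraph V}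

theorem IsTwin.adj_iff {a b w : V} (h : IsTwin G a b) (ha : w ≠ a) (hb : w ≠ b) :
    G.Adj a w ↔ G.Adj b w := by
  have := Set.ext_iff.1 h w
  simpa [ha, hb] using this

/-- A twin class induces a complete or an edgeless subgraph. -/
theorem twinClass_complete_or_edgeless {D : Finset V} {d : V} (hD : ∀ v ∈ D, IsTwin G d v) :
    (∀ u ∈ D, ∀ v ∈ D, u ≠ v → G.Adj u v) ∨ ∀ u ∈ D, ∀ v ∈ D, ¬ G.Adj u v := by
  have hrep : ∀ u ∈ D, ∀ v, u ≠ v → v ≠ d → (G.Adj u v ↔ G.Adj d v) := fun u hu v huv hv =>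
    ((hD u hu).adj_iff hv huv.symm).symm
  have hstep : ∀ u ∈ D, ∀ v ∈ D, u ≠ d → v ≠ d → (G.Adj d u ↔ G.Adj d v) := by
    intro u hu v hv hud hvd
    rcases eq_or_ne u v with rfl | huv
    · rfl
    · rw [← hrep v hv u huv.symm hud, ← hrep u hu v huv hvd, G.adj_comm]
  have hpair : ∀ u ∈ D, ∀ v ∈ D, u ≠ v → ∀ w ∈ D, w ≠ d → (G.Adj u v ↔ G.Adj d w) := by
    intro u hu v hv huv w hw hwd
    rcases eq_or_ne v d with rfl | hvd
    · rw [G.adj_comm, hstep u hu w hw huv hwd]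
    · rw [hrep u hu v huv hvd, hstep v hv w hw hvd hwd]
  by_contra! h
  obtain ⟨⟨u, hu, v, hv, huv, hnadj⟩, x, hx, y, hy, hadj⟩ := h
  obtain ⟨w, hw, hwd⟩ : ∃ w ∈ D, w ≠ d := by
    rcases eq_or_ne u d with rfl | hud
    exacts [⟨v, hv, huv.symm⟩, ⟨u, hu, hud⟩]
  exact hnadj ((hpair u hu v hv huv w hw hwd).2 ((hpair x hx y hy hadj.ne w hw hwd).1 hadj))

variable [Fintype V] [DecidableEq V] {k : ℕ} {C : Fin k → Finset V} {c : Fin k → V}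

/-- The Steiner distance of a set meeting at least two twin classes. -/
theorem steinerDist_of_meets_two_twinClasses (hconn : G.Connected)
    (hC : ∀ i, (C i : Set V) = {v | IsTwin G (c i) v}) (hcover : ∀ v, ∃ i, v ∈ C i)
    (hdisj : ∀ i j, i ≠ j → Disjoint (C i) (C j)) (S : Finset V)
    (hS : 2 ≤ (Finset.univ.filter fun i => (S ∩ C i).Nonempty).card) :
    steinerDist G (S : Set V) =
      steinerDist (G.induce (Set.range c))
          (Subtype.val ⁻¹'
            (((Finset.univ.filter fun i => (S ∩ C i).Nonempty).image c : Finset V) : Set V)) +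
        ∑ i ∈ Finset.univ.filter (fun i => (S ∩ C i).Nonempty), ((S ∩ C i).card - 1) := by
  have htwin : ∀ i, ∀ v ∈ C i, IsTwin G (c i) v := fun i v hv => by
    have : v ∈ (C i : Set V) := hv
    rwa [hC i] at this
  have hc : ∀ i, c i ∈ C i := fun i => by
    have : c i ∈ (C i : Set V) := by rw [hC i]; exact rfl
    exact this
  have hindex : ∀ {i j v}, v ∈ C i → v ∈ C j → i = j := fun {i j v} hi hj => by
    by_contra hij
    exact Finset.disjoint_left.1 (hdisj i j hij) hi hj
  have hcinj : Function.Injective c := fun i j hij => hindex (hc i) (hij ▸ hc j)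
  choose π hπ using hcover
  let e : Fin k → Set.range c := Set.rangeFactorization c
  have heinj : Function.Injective e := Set.rangeFactorization_injective.2 hcinj
  have hr : Function.Surjective (e ∘ π) := by
    rintro ⟨_, i, rfl⟩
    exact ⟨c i, congrArg e (hindex (hπ (c i)) (hc i))⟩
  have hadj : ∀ u v, (e ∘ π) u ≠ (e ∘ π) v →
      (G.Adj u v ↔ (G.induce (Set.range c)).Adj ((e ∘ π) u) ((e ∘ π) v)) := by
    intro u v huv
    have hne : π u ≠ π v := fun h => huv (congrArg e h)
    have hdist : ∀ x ∈ C (π u), ∀ y ∈ C (π v), x ≠ y := by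
      rintro x hx _ hy rfl
      exact hne (hindex hx hy)
    have h1 := (htwin _ u (hπ u)).adj_iff (hdist _ (hc _) v (hπ v)).symm
      (hdist u (hπ u) v (hπ v)).symm
    have h2 := (htwin _ v (hπ v)).adj_iff (hdist _ (hc (π u)) _ (hc (π v)))
      (hdist _ (hc _) v (hπ v))
    rw [← h1, G.adj_comm, ← h2, G.adj_comm]
    rfl
  set J := Finset.univ.filter fun i => (S ∩ C i).Nonempty with hJ
  have hJmem : ∀ i, i ∈ J ↔ ∃ v ∈ S, π v = i := by
    intro i
    simp only [hJ, Finset.mem_filter, Finset.mem_univ, true_and]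
    constructor
    · rintro ⟨v, hv⟩
      rw [Finset.mem_inter] at hv
      exact ⟨v, hv.1, hindex (hπ v) hv.2⟩
    · rintro ⟨v, hv, rfl⟩
      exact ⟨v, Finset.mem_inter.2 ⟨hv, hπ v⟩⟩
  have himage : (e ∘ π) '' (S : Set V) = e '' (J : Set (Fin k)) := by
    rw [Set.image_comp]
    congr 1
    ext i
    simp [hJmem]
  have hpre : Subtype.val ⁻¹' ((J.image c : Finset V) : Set V) = e '' (J : Set (Fin k)) := by
    ext ⟨x, hx⟩
    simp [e, Set.rangeFactorization, Subtype.ext_iff]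
  have hcardJ : (e '' (J : Set (Fin k))).ncard = J.card := by
    rw [Set.ncard_image_of_injective _ heinj, Set.ncard_coe_finset]
  have hnontriv : (e '' (J : Set (Fin k))).Nontrivial := by
    rw [← Set.one_lt_ncard_iff_nontrivial, hcardJ]
    omega
  have hmain := steinerDist_add_ncard_image hr hadj hconn (himage ▸ hnontriv)
  rw [himage, hcardJ, Set.ncard_coe_finset] at hmain
  have hcardS : S.card = ∑ i ∈ J, (S ∩ C i).card := by
    rw [Finset.card_eq_sum_card_fiberwise (f := π) (t := J) fun v hv => (hJmem _).2 ⟨v, hv, rfl⟩]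
    refine Finset.sum_congr rfl fun i _ => congrArg Finset.card ?_
    ext v
    simp only [Finset.mem_filter, Finset.mem_inter]
    exact and_congr_right fun _ => ⟨fun h => h ▸ hπ v, fun h => hindex (hπ v) h⟩
  have hsum : ∑ i ∈ J, (S ∩ C i).card = ∑ i ∈ J, ((S ∩ C i).card - 1) + J.card := by
    rw [Finset.card_eq_sum_ones, ← Finset.sum_add_distrib]
    refine Finset.sum_congr rfl fun i hi => ?_
    have := Finset.card_pos.2 (Finset.mem_filter.1 hi).2
    omega
  rw [hpre]
  omega

/-- The contribution of the `m`-subsets of a single twin class. -/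
theorem sum_steinerDist_twinClass [DecidableRel G.Adj] (hconn : G.Connected) {D : Finset V} {d : V}
    (hd : d ∈ D) (hD : ∀ v ∈ D, IsTwin G d v) {m : ℕ} (hm : 2 ≤ m) :
    ∑ S ∈ Finset.powersetCard m D, steinerDist G (S : Set V) =
      (if ∀ u ∈ D, ∀ v ∈ D, u ≠ v → G.Adj u v then (m - 1) * D.card.choose m else 0) +
        (if ∀ u ∈ D, ∀ v ∈ D, ¬ G.Adj u v then m * D.card.choose m else 0) := by
  rcases lt_or_ge D.card m with hlt | hge
  · simp [Nat.choose_eq_zero_of_lt hlt, Finset.powersetCard_eq_empty.2 hlt]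
  obtain ⟨a, ha, b, hb, hab⟩ := Finset.one_lt_card.1 (show 1 < D.card by omega)
  rcases twinClass_complete_or_edgeless hD with h | h
  · rw [if_pos h, if_neg fun h' => h' a ha b hb (h a ha b hb hab), add_zero, mul_comm,
      ← Finset.card_powersetCard]
    refine Finset.sum_const_nat fun S hS => ?_
    obtain ⟨hSD, hcard⟩ := Finset.mem_powersetCard.1 hS
    have hne : (S : Set V).Nonempty := Finset.card_pos.1 (by omega)
    have := steinerDist_of_isClique hconn hne fun u hu v hv => h u (hSD hu) v (hSD hv)
    rw [Set.ncard_coe_finset] at this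
    omega
  · rw [if_neg fun h' => h a ha b hb (h' a ha b hb hab), if_pos h, zero_add, mul_comm,
      ← Finset.card_powersetCard]
    have : Nontrivial V := ⟨a, b, hab⟩
    obtain ⟨z, hz⟩ := hconn.preconnected.exists_adj_of_nontrivial d
    have hzD : z ∉ D := fun hzD => h d hd z hzD hz
    refine Finset.sum_const_nat fun S hS => ?_
    obtain ⟨hSD, hcard⟩ := Finset.mem_powersetCard.1 hS
    have hnontriv : (S : Set V).Nontrivial :=
      Finset.one_lt_card_iff_nontrivial.1 (show 1 < S.card by omega)
    rw [steinerDist_of_isIndepSet hconn hnontriv (fun u hu v hv => h u (hSD hu) v (hSD hv))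
      (fun u hu => (((hD u (hSD hu)).adj_iff hz.ne' fun h => hzD (h ▸ hSD hu)).1 hz).symm),
      Set.ncard_coe_finset, hcard]

/-- The Steiner Wiener index of a finite connected graph in terms of its twin classes. -/
theorem steinerWiener_eq_sum_twinClasses [DecidableRel G.Adj] (hconn : G.Connected)
    (hC : ∀ i, (C i : Set V) = {v | IsTwin G (c i) v}) (hcover : ∀ v, ∃ i, v ∈ C i)
    (hdisj : ∀ i j, i ≠ j → Disjoint (C i) (C j)) {m : ℕ} (hm : 2 ≤ m) :
    steinerWiener m G =
      (∑ i ∈ Finset.univ.filter (fun i => ∀ u ∈ C i, ∀ v ∈ C i, u ≠ v → G.Adj u v),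
          (m - 1) * (C i).card.choose m) +
      (∑ i ∈ Finset.univ.filter (fun i => ∀ u ∈ C i, ∀ v ∈ C i, ¬ G.Adj u v),
          m * (C i).card.choose m) +
      ∑ S ∈ (Finset.powersetCard m Finset.univ).filter
          (fun S => 2 ≤ (Finset.univ.filter fun i => (S ∩ C i).Nonempty).card),
        (steinerDist (G.induce (Set.range c))
            (Subtype.val ⁻¹'
              (((Finset.univ.filter fun i => (S ∩ C i).Nonempty).image c : Finset V) : Set V)) +
          ∑ i ∈ Finset.univ.filter (fun i => (S ∩ C i).Nonempty), ((S ∩ C i).card - 1)) := by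
  have hsplit : (Finset.powersetCard m (Finset.univ : Finset V)).filter
      (fun S => ¬ 2 ≤ (Finset.univ.filter fun i => (S ∩ C i).Nonempty).card) =
      Finset.univ.biUnion fun i => Finset.powersetCard m (C i) := by
    ext S
    simp only [Finset.mem_filter, Finset.mem_powersetCard, Finset.subset_univ, true_and,
      Finset.mem_biUnion, Finset.mem_univ, not_le, Nat.lt_succ_iff, Finset.card_le_one]
    constructor
    · rintro ⟨hcard, hle⟩
      obtain ⟨v, hv⟩ := Finset.card_pos.1 (show 0 < S.card by omega)
      obtain ⟨i, hi⟩ := hcover v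
      refine ⟨i, fun w hw => ?_, hcard⟩
      obtain ⟨j, hj⟩ := hcover w
      exact hle i ⟨v, Finset.mem_inter.2 ⟨hv, hi⟩⟩ j ⟨w, Finset.mem_inter.2 ⟨hw, hj⟩⟩ ▸ hj
    · rintro ⟨i, hSi, hcard⟩
      have key : ∀ j, (S ∩ C j).Nonempty → i = j := by
        rintro j ⟨v, hv⟩
        rw [Finset.mem_inter] at hv
        by_contra hij
        exact Finset.disjoint_left.1 (hdisj i j hij) (hSi hv.1) hv.2
      exact ⟨hcard, fun j hj l hl => (key j hj).symm.trans (key l hl)⟩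
  have hpair : ((Finset.univ : Finset (Fin k)) : Set (Fin k)).PairwiseDisjoint
      fun i => Finset.powersetCard m (C i) := by
    intro i _ j _ hij
    refine Finset.disjoint_left.2 fun S hSi hSj => ?_
    obtain ⟨hSi, hcard⟩ := Finset.mem_powersetCard.1 hSi
    obtain ⟨v, hv⟩ := Finset.card_pos.1 (show 0 < S.card by omega)
    exact Finset.disjoint_left.1 (hdisj i j hij) (hSi hv) ((Finset.mem_powersetCard.1 hSj).1 hv)
  rw [steinerWiener, ← Finset.sum_filter_not_add_sum_filter _
    (fun S => 2 ≤ (Finset.univ.filter fun i => (S ∩ C i).Nonempty).card), hsplit,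
    Finset.sum_biUnion hpair]
  congr 1
  · rw [Finset.sum_filter, Finset.sum_filter, ← Finset.sum_add_distrib]
    refine Finset.sum_congr rfl fun i _ => sum_steinerDist_twinClass (d := c i) hconn ?_ ?_ hm
    · rw [← Finset.mem_coe, hC i]
      exact rfl
    · intro v hv
      rwa [← Finset.mem_coe, hC i] at hv
  · exact Finset.sum_congr rfl fun S hS =>
      steinerDist_of_meets_two_twinClasses hconn hC hcover hdisj S (Finset.mem_filter.1 hS).2

end TwinClasses

/-- Let `R` be a finite commutative ring with unity, `I` an ideal of
`R`, and assume the ideal-based zero-divisor graph `Γ_I(R)` is connected with at least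
`m` vertices, where `m ≥ 2`.  Let `C 1, …, C k` be the twin classes of `Γ_I(R)` with
sizes `n i = |C i|`, representatives `c i ∈ C i`, and reduced graph `H`.  Then
`SW_m(Γ_I(R)) = Σ_{i : complete} (m−1)·C(n i, m) + Σ_{i : edgeless} m·C(n i, m)
 + Σ_{S, |S| = m, |I(S)| > 1} (d_H(S_r) + Σ_{i ∈ I(S)} (t i − 1))`. -/
theorem steinerWiener_idealZeroDivisorGraph {R : Type*} [CommRing R] [Fintype R]
    [DecidableEq R] (I : Ideal R) [DecidablePred (· ∈ I)]
    (hconn : (idealZeroDivisorGraph R I).Connected)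
    (k : ℕ) (C : Fin k → Finset {x : R // x ∉ I ∧ ∃ y, y ∉ I ∧ x * y ∈ I})
    (c : Fin k → {x : R // x ∉ I ∧ ∃ y, y ∉ I ∧ x * y ∈ I})
    (hC : ∀ i, (C i : Set {x : R // x ∉ I ∧ ∃ y, y ∉ I ∧ x * y ∈ I}) =
      {v | IsTwin (idealZeroDivisorGraph R I) (c i) v})
    (hcover : ∀ v, ∃ i, v ∈ C i)
    (hdisj : ∀ i j, i ≠ j → Disjoint (C i) (C j))
    (m : ℕ) (hm : 2 ≤ m)
    (hmV : m ≤ Fintype.card {x : R // x ∉ I ∧ ∃ y, y ∉ I ∧ x * y ∈ I}) :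
    steinerWiener m (idealZeroDivisorGraph R I) =
      (∑ i ∈ Finset.univ.filter
          (fun i => ∀ u ∈ C i, ∀ v ∈ C i, u ≠ v → (idealZeroDivisorGraph R I).Adj u v),
          (m - 1) * (C i).card.choose m) +
      (∑ i ∈ Finset.univ.filter
          (fun i => ∀ u ∈ C i, ∀ v ∈ C i, ¬ (idealZeroDivisorGraph R I).Adj u v),
          m * (C i).card.choose m) +
      ∑ S ∈ (Finset.powersetCard m Finset.univ).filter
          (fun S => 2 ≤ (Finset.univ.filter fun i => (S ∩ C i).Nonempty).card),
        (steinerDist ((idealZeroDivisorGraph R I).induce (Set.range c))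
            (Subtype.val ⁻¹'
              ((((Finset.univ.filter fun i => (S ∩ C i).Nonempty).image c :
                Finset {x : R // x ∉ I ∧ ∃ y, y ∉ I ∧ x * y ∈ I}) :
                Set {x : R // x ∉ I ∧ ∃ y, y ∉ I ∧ x * y ∈ I}))) +
          ∑ i ∈ Finset.univ.filter (fun i => (S ∩ C i).Nonempty), ((S ∩ C i).card - 1)) := by
  exact steinerWiener_eq_sum_twinClasses hconn hC hcover hdisj hm
end

section
/- Let R be a finite commutative ring with unity, let I be an ideal of R, and assume the ideal-based zero-divisor graph Γ_I(R) is connected with at least two vertices. Let C_1, …, C_k be the twin classes of Γ_I(R) with sizes n_i = |C_i|, representatives c_i ∈ C_i, and reduced graph H. Then the Wiener index satisfies W(Γ_I(R)) = Σ_{i : Γ_I(R)[C_i] complete} C(n_i, 2) + Σ_{i : Γ_I(R)[C_i] edgeless} 2·C(n_i, 2) + Σ_{1 ≤ i < j ≤ k} n_i n_j d_H(c_i, c_j), where d_H(c_i, c_j) is the graph distance between c_i and c_j in H. -/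
open SimpleGraph

/-- The *Wiener index* of `G`: the sum of the graph distances over all unordered pairs
of distinct vertices of `G` (computed as half the sum over ordered pairs). -/
noncomputable def wienerIndex {V : Type*} [Fintype V] (G : SimpleGraph V) : ℕ :=
  (∑ u : V, ∑ v : V, G.dist u v) / 2

namespace SimpleGraph

section WalkMaps

variable {V W : Type*} {G : SimpleGraph V} {H : SimpleGraph W}

/-- A map sending adjacent vertices to equal or adjacent ones sends walks to walks that are
no longer. -/
theorem Walk.exists_length_le_of_adj_imp {f : V → W}
    (hf : ∀ a b, G.Adj a b → f a = f b ∨ H.Adj (f a) (f b)) {u v : V} (p : G.Walk u v) :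
    ∃ q : H.Walk (f u) (f v), q.length ≤ p.length := by
  induction p with
  | nil => exact ⟨.nil, le_rfl⟩
  | @cons a b w hab p ih =>
    obtain ⟨q, hq⟩ := ih
    rcases hf a b hab with h | h
    · rw [h]
      exact ⟨q, by rw [Walk.length_cons]; lia⟩
    · exact ⟨.cons h q, by rw [Walk.length_cons, Walk.length_cons]; lia⟩

theorem Reachable.map_of_adj_imp {f : V → W}
    (hf : ∀ a b, G.Adj a b → f a = f b ∨ H.Adj (f a) (f b)) {u v : V}
    (huv : G.Reachable u v) : H.Reachable (f u) (f v) := by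
  obtain ⟨p⟩ := huv
  obtain ⟨q, -⟩ := p.exists_length_le_of_adj_imp hf
  exact ⟨q⟩

theorem Reachable.dist_map_le_of_adj_imp {f : V → W}
    (hf : ∀ a b, G.Adj a b → f a = f b ∨ H.Adj (f a) (f b)) {u v : V}
    (huv : G.Reachable u v) : H.dist (f u) (f v) ≤ G.dist u v := by
  obtain ⟨p, hp⟩ := huv.exists_walk_length_eq_dist
  obtain ⟨q, hq⟩ := p.exists_length_le_of_adj_imp hf
  exact (dist_le q).trans (hq.trans hp.le)

end WalkMaps

section Twins

variable {V : Type*} {G : SimpleGraph V}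

theorem isTwin_refl (G : SimpleGraph V) (u : V) : IsTwin G u u := rfl

theorem _root_.IsTwin.adj_iff_s18 {u v w : V} (h : IsTwin G u v) (hu : w ≠ u) (hv : w ≠ v) :
    G.Adj u w ↔ G.Adj v w := by
  have := Set.ext_iff.mp h w
  simpa [hu, hv] using this

/-- A twin class induces a complete or an edgeless graph. -/
theorem twinClass_complete_or_edgeless (c : V) :
    (∀ u, IsTwin G c u → ∀ v, IsTwin G c v → u ≠ v → G.Adj u v) ∨
      ∀ u, IsTwin G c u → ∀ v, IsTwin G c v → ¬ G.Adj u v := by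
  by_cases h : ∃ x, IsTwin G c x ∧ G.Adj c x
  · left
    obtain ⟨x, hx, hcx⟩ := h
    have key : ∀ y, IsTwin G c y → c ≠ y → G.Adj c y := by
      intro y hy hne
      by_cases hyx : y = x
      · exact hyx ▸ hcx
      · have h1 : G.Adj y x := (hy.adj_iff_s18 hcx.ne' (Ne.symm hyx)).mp hcx
        exact (hx.adj_iff_s18 hne.symm hyx).mpr h1.symm
    intro u hu v hv huv
    by_cases hcv : c = v
    · subst hcv
      exact (key u hu huv.symm).symm
    · exact (hu.adj_iff_s18 (Ne.symm hcv) huv.symm).mp (key v hv hcv)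
  · right
    intro u hu v hv huv
    by_cases hcv : c = v
    · subst hcv
      exact h ⟨u, hu, huv.symm⟩
    · exact h ⟨v, hv, (hu.adj_iff_s18 (Ne.symm hcv) huv.ne').mpr huv⟩

/-- Distinct nonadjacent twins of a connected graph, given through a common twin `c`, are at
distance two. -/
theorem Connected.dist_eq_two_of_isTwin (hG : G.Connected) {c u v : V}
    (hu : IsTwin G c u) (hv : IsTwin G c v) (huv : u ≠ v)
    (hedge : ∀ a, IsTwin G c a → ∀ b, IsTwin G c b → ¬ G.Adj a b) : G.dist u v = 2 := by
  have : Nontrivial V := ⟨u, v, huv⟩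
  obtain ⟨w, hw⟩ := hG.preconnected.exists_adj_of_nontrivial u
  have hwc : w ≠ c := by
    rintro rfl
    exact hedge u hu _ (isTwin_refl G _) hw
  have hwv : w ≠ v := by
    rintro rfl
    exact hedge u hu _ hv hw
  have hvw : G.Adj v w := (hv.adj_iff_s18 hwc hwv).mp ((hu.adj_iff_s18 hwc hw.ne').mpr hw)
  have hle : G.dist u v ≤ 2 := dist_le (Walk.cons hw (Walk.cons hvw.symm Walk.nil))
  have h0 : G.dist u v ≠ 0 := fun h => huv (hG.dist_eq_zero_iff.mp h)
  have h1 : G.dist u v ≠ 1 := fun h => hedge u hu v hv (dist_eq_one_iff_adj.mp h)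
  lia

end Twins

section TwinPartition

variable {V ι : Type*} {G : SimpleGraph V} {c : ι → V} {cls : V → ι}

/-- Adjacency between distinct twin classes does not depend on the chosen members. -/
theorem adj_of_isTwin_of_cls_ne (hcls : ∀ i v, IsTwin G (c i) v ↔ cls v = i)
    {a a' b b' : V} (ha : cls a = cls a') (hb : cls b = cls b') (hne : cls a ≠ cls b)
    (hab : G.Adj a b) : G.Adj a' b' := by
  have hc : ∀ i, cls (c i) = i := fun i => (hcls i _).mp (isTwin_refl G _)
  have move : ∀ {x x' y : V}, cls x = cls x' → cls x ≠ cls y → G.Adj x y → G.Adj x' y := by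
    intro x x' y hx hxy h
    have hyc : y ≠ c (cls x) := by
      rintro rfl
      exact hxy (hc _).symm
    have hyx' : y ≠ x' := by
      rintro rfl
      exact hxy hx
    exact (((hcls (cls x) x').mpr hx.symm).adj_iff_s18 hyc hyx').mp
      ((((hcls (cls x) x).mpr rfl).adj_iff_s18 hyc h.ne').mpr h)
  have h := move ha hne hab
  exact (move hb (fun h' => hne (ha.trans h'.symm)) h.symm).symm

/-- The distance between members of distinct twin classes is the distance of the
representatives in the reduced graph. -/
theorem Connected.dist_eq_dist_induce_range (hG : G.Connected)
    (hcls : ∀ i v, IsTwin G (c i) v ↔ cls v = i) {u v : V} (huv : cls u ≠ cls v) :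
    G.dist u v = (G.induce (Set.range c)).dist
      ⟨c (cls u), Set.mem_range_self _⟩ ⟨c (cls v), Set.mem_range_self _⟩ := by
  classical
  have hc : ∀ i, cls (c i) = i := fun i => (hcls i _).mp (isTwin_refl G _)
  let f : V → Set.range c := fun x => ⟨c (cls x), Set.mem_range_self _⟩
  have hf : ∀ a b, G.Adj a b → f a = f b ∨ (G.induce (Set.range c)).Adj (f a) (f b) := by
    intro a b hab
    by_cases h : cls a = cls b
    · exact Or.inl (by simp only [f, h])
    · exact Or.inr (adj_of_isTwin_of_cls_ne hcls (hc _).symm (hc _).symm h hab)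
  let g : Set.range c → V := fun x =>
    if cls x = cls u then u else if cls x = cls v then v else x
  have hgcls : ∀ x, cls (g x) = cls x := by
    intro x
    simp only [g]
    split_ifs <;> simp_all
  have hg : ∀ a b, (G.induce (Set.range c)).Adj a b → g a = g b ∨ G.Adj (g a) (g b) := by
    rintro ⟨_, i, rfl⟩ ⟨_, j, rfl⟩ hab
    have hij : cls (c i) ≠ cls (c j) := by
      rw [hc, hc]
      rintro rfl
      exact hab.ne rfl
    exact Or.inr (adj_of_isTwin_of_cls_ne hcls (hgcls _).symm (hgcls _).symm hij hab)
  have hgu : g (f u) = u := by simp [g, f, hc]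
  have hgv : g (f v) = v := by simp [g, f, hc, huv.symm]
  apply le_antisymm
  · have h := ((hG u v).map_of_adj_imp hf).dist_map_le_of_adj_imp hg
    rwa [hgu, hgv] at h
  · exact (hG u v).dist_map_le_of_adj_imp hf

end TwinPartition

end SimpleGraph

/-- The sum over ordered pairs of a function that is constant off the diagonal of `s` and
zero on it. -/
theorem Finset.sum_sum_eq_mul_choose_two {α : Type*} (s : Finset α) (d : α → α → ℕ) (m : ℕ)
    (hdiag : ∀ u, d u u = 0) (hoff : ∀ u ∈ s, ∀ v ∈ s, u ≠ v → d u v = m) :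
    ∑ u ∈ s, ∑ v ∈ s, d u v = 2 * (m * s.card.choose 2) := by
  classical
  have hrow : ∀ u ∈ s, ∑ v ∈ s, d u v = (s.card - 1) * m := by
    intro u hu
    rw [← Finset.add_sum_erase s _ hu, hdiag, zero_add,
      Finset.sum_congr rfl fun v hv => hoff u hu v (Finset.mem_of_mem_erase hv)
        (Finset.ne_of_mem_erase hv).symm,
      Finset.sum_const, Finset.card_erase_of_mem hu, smul_eq_mul]
  have htri : s.card.choose 2 * 2 = s.card * (s.card - 1) := by
    rw [Nat.choose_two_right, Nat.div_mul_cancel (Nat.even_mul_pred_self _).two_dvd]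
  rw [Finset.sum_congr rfl hrow, Finset.sum_const, smul_eq_mul, ← mul_assoc, ← htri]
  ring

/-- A symmetric sum over ordered pairs is its diagonal plus twice its strict upper part. -/
theorem Finset.sum_sum_eq_diag_add_two_mul {ι : Type*} [Fintype ι] [LinearOrder ι]
    (S : ι → ι → ℕ) (hS : ∀ i j, S i j = S j i) :
    ∑ i, ∑ j, S i j =
      ∑ i, S i i + 2 * ∑ p ∈ Finset.univ.filter (fun p : ι × ι => p.1 < p.2), S p.1 p.2 := by
  have hswap : ∑ p ∈ Finset.univ.filter (fun p : ι × ι => p.2 < p.1), S p.1 p.2 =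
      ∑ p ∈ Finset.univ.filter (fun p : ι × ι => p.1 < p.2), S p.1 p.2 :=
    Finset.sum_equiv (Equiv.prodComm ι ι) (by simp) (fun p _ => hS _ _)
  have hdiag : ∑ i, S i i = ∑ p : ι × ι, if p.1 = p.2 then S p.1 p.2 else 0 := by
    simp [Fintype.sum_prod_type]
  rw [two_mul]
  nth_rewrite 1 [← hswap]
  rw [hdiag, Finset.sum_filter, Finset.sum_filter, ← Finset.sum_add_distrib,
    ← Finset.sum_add_distrib, ← Fintype.sum_prod_type']
  refine Finset.sum_congr rfl fun p _ => ?_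
  rcases lt_trichotomy p.1 p.2 with h | h | h
  · simp [h, h.ne, h.not_gt]
  · simp [h]
  · simp [h, h.ne', h.not_gt]

/-- Let `R` be a finite commutative ring with unity, `I` an ideal of
`R`, and assume the ideal-based zero-divisor graph `Γ_I(R)` is connected with at least
two vertices.  Let `C 1, …, C k` be the twin classes of `Γ_I(R)` with sizes
`n i = |C i|`, representatives `c i ∈ C i`, and reduced graph `H`.  Then
`W(Γ_I(R)) = Σ_{i : complete} C(n i, 2) + Σ_{i : edgeless} 2·C(n i, 2)
 + Σ_{i < j} n i · n j · d_H(c i, c j)`. -/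
theorem wienerIndex_idealZeroDivisorGraph {R : Type*} [CommRing R] [Fintype R]
    [DecidableEq R] (I : Ideal R) [DecidablePred (· ∈ I)]
    (hconn : (idealZeroDivisorGraph R I).Connected)
    (hV : 2 ≤ Fintype.card {x : R // x ∉ I ∧ ∃ y, y ∉ I ∧ x * y ∈ I})
    (k : ℕ) (C : Fin k → Finset {x : R // x ∉ I ∧ ∃ y, y ∉ I ∧ x * y ∈ I})
    (c : Fin k → {x : R // x ∉ I ∧ ∃ y, y ∉ I ∧ x * y ∈ I})
    (hC : ∀ i, (C i : Set {x : R // x ∉ I ∧ ∃ y, y ∉ I ∧ x * y ∈ I}) =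
      {v | IsTwin (idealZeroDivisorGraph R I) (c i) v})
    (hcover : ∀ v, ∃ i, v ∈ C i)
    (hdisj : ∀ i j, i ≠ j → Disjoint (C i) (C j)) :
    wienerIndex (idealZeroDivisorGraph R I) =
      (∑ i ∈ Finset.univ.filter
          (fun i => ∀ u ∈ C i, ∀ v ∈ C i, u ≠ v → (idealZeroDivisorGraph R I).Adj u v),
          (C i).card.choose 2) +
      (∑ i ∈ Finset.univ.filter
          (fun i => ∀ u ∈ C i, ∀ v ∈ C i, ¬ (idealZeroDivisorGraph R I).Adj u v),
          2 * (C i).card.choose 2) +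
      ∑ p ∈ Finset.univ.filter (fun p : Fin k × Fin k => p.1 < p.2),
        (C p.1).card * (C p.2).card *
          ((idealZeroDivisorGraph R I).induce (Set.range c)).dist
            ⟨c p.1, Set.mem_range_self p.1⟩ ⟨c p.2, Set.mem_range_self p.2⟩ := by
  set G := idealZeroDivisorGraph R I
  have hmem : ∀ i v, v ∈ C i ↔ IsTwin G (c i) v := fun i v => by
    rw [← Finset.mem_coe, hC i, Set.mem_ofPred_eq]
  choose cls hcls_mem using hcover
  have hmem_cls : ∀ i v, v ∈ C i ↔ cls v = i := by
    refine fun i v => ⟨fun h => ?_, fun h => h ▸ hcls_mem v⟩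
    by_contra hne
    exact Finset.disjoint_left.mp (hdisj _ _ hne) (hcls_mem v) h
  have hcls : ∀ i v, IsTwin G (c i) v ↔ cls v = i := fun i v =>
    (hmem i v).symm.trans (hmem_cls i v)
  have hsplit : ∀ F : {x : R // x ∉ I ∧ ∃ y, y ∉ I ∧ x * y ∈ I} → ℕ,
      ∑ v, F v = ∑ i, ∑ v ∈ C i, F v := by
    intro F
    rw [← Finset.sum_fiberwise Finset.univ cls F]
    refine Finset.sum_congr rfl fun i _ => Finset.sum_congr ?_ fun _ _ => rfl
    ext v
    simp [hmem_cls]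
  have htotal : ∑ u, ∑ v, G.dist u v = ∑ i, ∑ j, ∑ u ∈ C i, ∑ v ∈ C j, G.dist u v := by
    rw [hsplit]
    refine Finset.sum_congr rfl fun i _ => ?_
    rw [Finset.sum_congr rfl fun u _ => hsplit (G.dist u), Finset.sum_comm]
  have hoff : ∀ p ∈ Finset.univ.filter (fun p : Fin k × Fin k => p.1 < p.2),
      ∑ u ∈ C p.1, ∑ v ∈ C p.2, G.dist u v = (C p.1).card * (C p.2).card *
        (G.induce (Set.range c)).dist
          ⟨c p.1, Set.mem_range_self p.1⟩ ⟨c p.2, Set.mem_range_self p.2⟩ := by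
    rintro ⟨i, j⟩ hp
    have hij : i ≠ j := (Finset.mem_filter.mp hp).2.ne
    have hconst : ∀ u ∈ C i, ∀ v ∈ C j, G.dist u v = (G.induce (Set.range c)).dist
        ⟨c i, Set.mem_range_self i⟩ ⟨c j, Set.mem_range_self j⟩ := by
      intro u hu v hv
      obtain rfl := (hmem_cls i u).mp hu
      obtain rfl := (hmem_cls j v).mp hv
      exact hconn.dist_eq_dist_induce_range hcls hij
    rw [Finset.sum_congr rfl fun u hu => Finset.sum_congr rfl (hconst u hu)]
    simp [mul_assoc]
  have hdiag : ∀ i, ∑ u ∈ C i, ∑ v ∈ C i, G.dist u v =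
      2 * ((if ∀ u ∈ C i, ∀ v ∈ C i, u ≠ v → G.Adj u v then (C i).card.choose 2 else 0) +
        if ∀ u ∈ C i, ∀ v ∈ C i, ¬ G.Adj u v then 2 * (C i).card.choose 2 else 0) := by
    intro i
    have hcases := twinClass_complete_or_edgeless (G := G) (c i)
    simp only [← hmem] at hcases
    by_cases hcompl : ∀ u ∈ C i, ∀ v ∈ C i, u ≠ v → G.Adj u v
    · rw [Finset.sum_sum_eq_mul_choose_two (C i) G.dist 1 (fun _ => dist_self)
        fun u hu v hv huv => dist_eq_one_iff_adj.mpr (hcompl u hu v hv huv),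
        if_pos hcompl, one_mul]
      split_ifs with hedge
      · have hcard : (C i).card ≤ 1 := Finset.card_le_one.mpr fun u hu v hv => by
          by_contra huv
          exact hedge u hu v hv (hcompl u hu v hv huv)
        rw [Nat.choose_eq_zero_of_lt (by lia)]
      · rw [add_zero]
    · have hedge := hcases.resolve_left hcompl
      rw [if_neg hcompl, if_pos hedge, zero_add]
      refine Finset.sum_sum_eq_mul_choose_two (C i) G.dist 2 (fun _ => dist_self) ?_
      intro u hu v hv huv
      simp only [hmem] at hedge hu hv
      exact hconn.dist_eq_two_of_isTwin hu hv huv hedge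
  have hsymm : ∀ i j, ∑ u ∈ C i, ∑ v ∈ C j, G.dist u v =
      ∑ u ∈ C j, ∑ v ∈ C i, G.dist u v := by
    intro i j
    rw [Finset.sum_comm]
    exact Finset.sum_congr rfl fun v _ => Finset.sum_congr rfl fun u _ => SimpleGraph.dist_comm
  rw [wienerIndex, htotal, Finset.sum_sum_eq_diag_add_two_mul _ hsymm,
    Finset.sum_congr rfl hoff, Finset.sum_congr rfl fun i _ => hdiag i, ← Finset.mul_sum,
    ← mul_add, Nat.mul_div_cancel_left _ two_pos, Finset.sum_add_distrib]
  simp only [Finset.sum_filter]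
  rfl
end
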